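/- Let d ≥ 1 and assume that DHL(d) holds. Let T⃗ = (T_1,…,T_d) be a vector homogeneous tree, W a homogeneous tree, 0 < ε ≤ 1 and D : ⊗T⃗ → 2^W an ε-dense level selection. Then there exist a vector strong subtree R⃗ of T⃗, a node w ∈ W and a constant 0 < θ ≤ 1 such that the pair (R⃗, w) is strongly θ-correlated with respect to D. -/

import Mathlib

open Filter

namespace DHLPaper

/-- The tree `b^{<ℕ}` of all finite sequences with values in `{0,…,b−1}`,
partially ordered by end-extension (`List.IsPrefix`, written `<+:`). -/
def bSeq (b : ℕ) : Set (List ℕ) := {t | ∀ x ∈ t, x < b}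

/-- The set of successors of `t` in `T`: `Suc_T(t) = {s ∈ T : t ≤ s}`. -/
def suc (T : Set (List ℕ)) (t : List ℕ) : Set (List ℕ) := {s ∈ T | t <+: s}

/-- `s` is an immediate successor of `t` in `T`. -/
def ImmSuc (T : Set (List ℕ)) (t s : List ℕ) : Prop :=
  t ∈ T ∧ s ∈ T ∧ t <+: s ∧ t ≠ s ∧ ∀ u ∈ T, t <+: u → u <+: s → u = t ∨ u = s

/-- The `n`-th level of `T`: the nodes of `T` with exactly `n` strict predecessors in `T`. -/
def level (T : Set (List ℕ)) (n : ℕ) : Set (List ℕ) :=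
  {t ∈ T | {s ∈ T | s <+: t ∧ s ≠ t}.ncard = n}

/-- `T` has exactly one minimal node. -/
def UniquelyRooted (T : Set (List ℕ)) : Prop := ∃! r, r ∈ level T 0

/-- Every node of `T` has finitely many immediate successors in `T`. -/
def FinitelyBranching (T : Set (List ℕ)) : Prop := ∀ t ∈ T, {s | ImmSuc T t s}.Finite

/-- Every node of `T` has at least one immediate successor in `T`. -/
def Pruned (T : Set (List ℕ)) : Prop := ∀ t ∈ T, ∃ s, ImmSuc T t s

/-- `S` is a strong subtree of `T` whose level set `L_T(S)` is enumerated by the strictly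
increasing map `l`: `S(n) ⊆ T(l n)` for every `n`, `S` is uniquely rooted, and for every
`s ∈ S` and every immediate successor `t` of `s` in `T` there is a unique immediate
successor `s'` of `s` in `S` with `t ≤ s'`. -/
def IsStrongSubtreeWith (T S : Set (List ℕ)) (l : ℕ → ℕ) : Prop :=
  S ⊆ T ∧ UniquelyRooted S ∧ StrictMono l ∧
    (∀ n, level S n ⊆ level T (l n)) ∧
    (∀ s ∈ S, ∀ t, ImmSuc T s t → ∃! s', ImmSuc S s s' ∧ t <+: s')

/-- `S` is a strong subtree of `T`. -/
def IsStrongSubtree (T S : Set (List ℕ)) : Prop := ∃ l, IsStrongSubtreeWith T S l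

/-- A homogeneous tree with branching number `b`: a strong subtree of `b^{<ℕ}`, `b ≥ 2`. -/
def IsHomogeneous (b : ℕ) (T : Set (List ℕ)) : Prop := 2 ≤ b ∧ IsStrongSubtree (bSeq b) T

/-- A vector homogeneous tree: a `d`-tuple of homogeneous trees. -/
def IsVecHomogeneous {d : ℕ} (b : Fin d → ℕ) (T : Fin d → Set (List ℕ)) : Prop :=
  ∀ i, IsHomogeneous (b i) (T i)

/-- Vector strong subtree: componentwise strong subtrees with a common level set. -/
def IsVecStrongSubtree {d : ℕ} (T S : Fin d → Set (List ℕ)) : Prop :=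
  ∃ l, ∀ i, IsStrongSubtreeWith (T i) (S i) l

/-- `⊗T(n) = T_1(n) × ⋯ × T_d(n)`. -/
def vecLevel {d : ℕ} (T : Fin d → Set (List ℕ)) (n : ℕ) : Set (Fin d → List ℕ) :=
  {v | ∀ i, v i ∈ level (T i) n}

/-- The level product `⊗T = ⋃_n ⊗T(n)`. -/
def levelProd {d : ℕ} (T : Fin d → Set (List ℕ)) : Set (Fin d → List ℕ) :=
  ⋃ n, vecLevel T n

/-- `r` is the root tuple of the vector tree `T`. -/
def IsRoot {d : ℕ} (T : Fin d → Set (List ℕ)) (r : Fin d → List ℕ) : Prop :=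
  ∀ i, level (T i) 0 = {r i}

/-- `F` is a vector fan of `T`: `F = (R_1(0) ∪ R_1(1), …, R_d(0) ∪ R_d(1))` for some
vector strong subtree `R` of `T`. -/
def IsVecFan {d : ℕ} (T F : Fin d → Set (List ℕ)) : Prop :=
  ∃ R : Fin d → Set (List ℕ), IsVecStrongSubtree T R ∧
    ∀ i, F i = level (R i) 0 ∪ level (R i) 1

/-- `fan(T,n)`: the vector fans of `T` with `⊗F(1) ⊆ ⊗T(n)`. -/
def fanAt {d : ℕ} (T : Fin d → Set (List ℕ)) (n : ℕ) : Set (Fin d → Set (List ℕ)) :=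
  {F | IsVecFan T F ∧ vecLevel F 1 ⊆ vecLevel T n}

/-- Density of `F ⊆ W(n)` in the `n`-th level of `W`. -/
noncomputable def dens (W : Set (List ℕ)) (n : ℕ) (F : Set (List ℕ)) : ℝ :=
  (F.ncard : ℝ) / ((level W n).ncard : ℝ)

/-- Density of `F ⊆ W(n)` relative to the node `w`. -/
noncomputable def densRel (W : Set (List ℕ)) (n : ℕ) (F : Set (List ℕ)) (w : List ℕ) : ℝ :=
  ((F ∩ suc W w).ncard : ℝ) / ((level W n ∩ suc W w).ncard : ℝ)

/-- `s = w ⌢_W p`: `s` is the immediate successor of `w` in `W` such that the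
concatenation `w ⌢ p` is an initial segment of `s`. -/
def IsConcat (W : Set (List ℕ)) (w : List ℕ) (p : ℕ) (s : List ℕ) : Prop :=
  ImmSuc W w s ∧ w ++ [p] <+: s

/-- The density Halpern–Läuchli statement in dimension `d`. -/
def DHL (d : ℕ) : Prop :=
  ∀ (b : Fin d → ℕ) (T : Fin d → Set (List ℕ)), IsVecHomogeneous b T →
    ∀ D : Set (Fin d → List ℕ), D ⊆ levelProd T →
      0 < Filter.limsup
          (fun n => ((D ∩ vecLevel T n).ncard : ℝ) / ((vecLevel T n).ncard : ℝ)) atTop →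
      ∃ S : Fin d → Set (List ℕ), IsVecStrongSubtree T S ∧ levelProd S ⊆ D

/-- `D : ⊗T → 2^W` is an `ε`-dense level selection along the strictly increasing
sequence `l`: for every `n` and every `t⃗ ∈ ⊗T(n)`, `D(t⃗) ⊆ W(l n)` and
`dens(D(t⃗)) ≥ ε`. -/
def IsDenseLevelSel {d : ℕ} (T : Fin d → Set (List ℕ)) (W : Set (List ℕ)) (l : ℕ → ℕ)
    (ε : ℝ) (D : (Fin d → List ℕ) → Set (List ℕ)) : Prop :=
  StrictMono l ∧ ∀ n, ∀ v ∈ vecLevel T n, D v ⊆ level W (l n) ∧ ε ≤ dens W (l n) (D v)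

/-- The pair `(R, w)` (`R` a vector strong subtree of `T` with root tuple `r0`) is strongly
`θ`-correlated with respect to the dense level selection `D` (with level sequence `l`):
`w ∈ D(r0)` and for every vector fan `F` of `R` with `F(0) = r0` and every `p < b_W`,
`dens(⋂_{r ∈ ⊗F(1)} D(r) | w ⌢_W p) ≥ θ`. -/
def StronglyCorrelated {d : ℕ} (T : Fin d → Set (List ℕ)) (W : Set (List ℕ)) (bW : ℕ)
    (l : ℕ → ℕ) (D : (Fin d → List ℕ) → Set (List ℕ)) (R : Fin d → Set (List ℕ))
    (r0 : Fin d → List ℕ) (w : List ℕ) (θ : ℝ) : Prop :=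
  w ∈ D r0 ∧
    ∀ F : Fin d → Set (List ℕ), IsVecFan R F → IsRoot F r0 →
      ∀ n, vecLevel F 1 ⊆ vecLevel T n →
        ∀ p < bW, ∀ s, IsConcat W w p s →
          θ ≤ densRel W (l n) (⋂ r ∈ vecLevel F 1, D r) s

section CarlsonSimpson

/-- A compact Hausdorff semigroup with continuous right translations has a left ideal `L` that is
generated by each of its elements. -/
theorem exists_minimal_left_ideal {M : Type*} [Nonempty M] [Semigroup M] [TopologicalSpace M]
    [CompactSpace M] [T2Space M] (hcont : ∀ r : M, Continuous (· * r)) :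
    ∃ L : Set M, L.Nonempty ∧ (∀ x, ∀ y ∈ L, x * y ∈ L) ∧
      ∀ y ∈ L, ∀ e ∈ L, ∃ x, x * e = y := by
  let S : Set (Set M) := {N | IsClosed N ∧ N.Nonempty ∧ ∀ x, ∀ y ∈ N, x * y ∈ N}
  obtain ⟨L, hL⟩ : ∃ L, Minimal (· ∈ S) L := by
    refine zorn_superset _ fun c hcs hc => ?_
    refine ⟨⋂₀ c, ⟨isClosed_sInter fun t ht => (hcs ht).1, ?_, fun x y hy => ?_⟩,
      fun s hs => Set.sInter_subset_of_mem hs⟩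
    · obtain rfl | hcnemp := c.eq_empty_or_nonempty
      · rw [Set.sInter_empty]
        exact Set.univ_nonempty
      convert!
        @IsCompact.nonempty_iInter_of_directed_nonempty_isCompact_isClosed _ _ _
          hcnemp.coe_sort ((↑) : c → Set M) ?_ ?_ ?_ ?_
      · exact Set.sInter_eq_iInter
      · exact DirectedOn.directed_val (IsChain.directedOn hc.symm)
      exacts [fun i => (hcs i.prop).2.1, fun i => (hcs i.prop).1.isCompact,
        fun i => (hcs i.prop).1]
    · exact Set.mem_sInter.2 fun t ht => (hcs ht).2.2 x y (Set.mem_sInter.1 hy t ht)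
  refine ⟨L, hL.prop.2.1, hL.prop.2.2, fun y hy e he => ?_⟩
  have hmem : Set.range (· * e) ∈ S := by
    refine ⟨(isCompact_range (hcont e)).isClosed, Set.range_nonempty _, ?_⟩
    rintro x _ ⟨z, rfl⟩
    exact ⟨x * z, mul_assoc _ _ _⟩
  have hsub : Set.range (· * e) ⊆ L := by
    rintro _ ⟨z, rfl⟩
    exact hL.prop.2.2 z e he
  exact hL.le_of_le hmem hsub hy

attribute [local instance] Ultrafilter.mul Ultrafilter.semigroup

theorem map_ultrafilter_mul {M N : Type*} [Monoid M] [Monoid N] (f : M →* N)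
    (U V : Ultrafilter M) : (U * V).map f = U.map f * V.map f := by
  refine Ultrafilter.coe_inj.mp <| Filter.ext' fun p => ?_
  simp only [Ultrafilter.coe_map, Filter.eventually_map, Ultrafilter.eventually_mul, map_mul]

variable {A : Type*}

/-- Substitution of the letter `a` for the variable `none`. -/
def subst (a : A) : FreeMonoid (Option A) →* FreeMonoid A :=
  FreeMonoid.map fun o => o.getD a

/-- An ultrafilter on words starting with the variable, all of whose substitution instances
absorb each other from the right. -/
theorem exists_left_variable_ultrafilter [Nonempty A] :
    ∃ q : Ultrafilter (FreeMonoid (Option A)),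
      (∀ᶠ x in (q : Filter (FreeMonoid (Option A))), ∃ y, x = FreeMonoid.of none * y) ∧
      ∀ a a' : A, q.map (subst a) * q.map (subst a') = q.map (subst a) := by
  obtain ⟨L, ⟨p, hp⟩, hL, hgen⟩ := exists_minimal_left_ideal
    (M := Ultrafilter (FreeMonoid A)) Ultrafilter.continuous_mul_left
  let emb : FreeMonoid A →* FreeMonoid (Option A) := FreeMonoid.map some
  have hemb : ∀ a, (p.map emb).map (subst a) = p := by
    intro a
    have : (subst a : FreeMonoid (Option A) → FreeMonoid A) ∘ emb = id := by
      funext w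
      simp [emb, subst, FreeMonoid.map_map, Function.comp_def,
        show (fun x : A => x) = id from rfl]
    rw [Ultrafilter.map_map, this, Ultrafilter.map_id]
  let V : Set (Ultrafilter (FreeMonoid (Option A))) :=
    {x | {x | ∃ y, x = FreeMonoid.of none * y} ∈ x}
  have hV : IsClosed V := ultrafilter_isClosed_basic _
  have hVmul : ∀ x ∈ V, ∀ y, x * y ∈ V := by
    intro x hx y
    refine (Ultrafilter.eventually_mul x y _).2 ?_
    filter_upwards [hx] with m hm
    obtain ⟨z, rfl⟩ := hm
    exact Eventually.of_forall fun m' => ⟨z * m', mul_assoc _ _ _⟩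
  obtain ⟨q, ⟨x, hx, rfl⟩, hq⟩ := exists_idempotent_in_compact_subsemigroup
    Ultrafilter.continuous_mul_left ((· * p.map emb) '' V)
    ⟨_, _, show pure (FreeMonoid.of none) ∈ V from ⟨1, (mul_one _).symm⟩, rfl⟩
    (hV.isCompact.image (Ultrafilter.continuous_mul_left _)) (by
      rintro _ ⟨x, hx, rfl⟩ _ ⟨y, hy, rfl⟩
      exact ⟨x * p.map emb * y, hVmul _ (hVmul _ hx _) _, mul_assoc _ _ _⟩)
  refine ⟨x * p.map emb, hVmul x hx (p.map emb), fun a a' => ?_⟩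
  have hmem : ∀ a, (x * p.map emb).map (subst a) ∈ L := by
    intro a
    rw [map_ultrafilter_mul, hemb]
    exact hL _ _ hp
  obtain ⟨z, hz⟩ := hgen _ (hmem a) _ (hmem a')
  rw [← hz, mul_assoc, ← map_ultrafilter_mul, hq]

/-- The Carlson–Simpson theorem: for every finite colouring of words there are a word `u` and
words `x n` such that all the words `u a₀ x₀(a₀) ⋯ aₙ xₙ(aₙ)` have the same colour. -/
theorem carlson_simpson [Finite A] [Nonempty A] {κ : Type*} [Finite κ] (c : FreeMonoid A → κ) :
    ∃ (k : κ) (e : List A → FreeMonoid A) (x : ℕ → FreeMonoid (Option A)),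
      (∀ w a, e (w ++ [a]) = e w * (.of a * subst a (x w.length))) ∧ ∀ w, c (e w) = k := by
  obtain ⟨q, hvar, hq⟩ := exists_left_variable_ultrafilter (A := A)
  let a₀ : A := Classical.arbitrary A
  obtain ⟨k, hk⟩ : ∃ k, ∀ᶠ w in (q.map (subst a₀) : Filter (FreeMonoid A)), c w = k :=
    Ultrafilter.eventually_exists_iff.1 (Eventually.of_forall fun w => ⟨c w, rfl⟩)
  let C : Set (FreeMonoid A) := {u | c u = k ∧ ∀ a : A, ∀ᶠ y in (q : Filter (FreeMonoid (Option A))),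
    c (u * subst a y) = k}
  obtain ⟨u₀, hu₀⟩ : ∃ u₀, u₀ ∈ C := by
    have hk' : ∀ a : A, ∀ᶠ u in (q.map (subst a₀) : Filter (FreeMonoid A)),
        ∀ᶠ y in (q : Filter (FreeMonoid (Option A))), c (u * subst a y) = k := by
      intro a
      rw [← hq a₀ a, Ultrafilter.eventually_mul] at hk
      exact hk
    exact (hk.and (eventually_all.2 hk')).exists
  have hstep : ∀ u ∈ C, ∀ a, ∀ᶠ y in (q : Filter (FreeMonoid (Option A))),
      u * subst a y ∈ C := by
    intro u hu a
    refine (hu.2 a).and (eventually_all.2 fun a' => ?_)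
    have h : ∀ᶠ z in (q.map (subst a) : Filter (FreeMonoid A)), c (u * z) = k :=
      hu.2 a
    rw [← hq a a', Ultrafilter.eventually_mul] at h
    refine (show ∀ᶠ y in (q : Filter (FreeMonoid (Option A))),
      ∀ᶠ z in (q : Filter (FreeMonoid (Option A))),
        c (u * (subst a y * subst a' z)) = k from h).mono fun y hy => ?_
    simpa only [mul_assoc] using hy
  let inst (x : FreeMonoid (Option A)) (a : A) : FreeMonoid A := .of a * subst a x
  have hX : ∀ E : Set (FreeMonoid A), ∃ x : FreeMonoid (Option A), E.Finite → E ⊆ C →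
      ∀ u ∈ E, ∀ a, u * inst x a ∈ C := by
    intro E
    by_cases hE : E.Finite ∧ E ⊆ C
    · have hall : ∀ᶠ y in (q : Filter (FreeMonoid (Option A))), ∀ u ∈ E, ∀ a,
          u * subst a y ∈ C :=
        (eventually_all_finite hE.1).2 fun u hu => eventually_all.2 fun a => hstep u (hE.2 hu) a
      obtain ⟨_, hy, z, rfl⟩ := (hall.and hvar).exists
      exact ⟨z, fun _ _ u hu a => by simpa [inst, subst] using hy u hu a⟩
    · exact ⟨1, fun h₁ h₂ => absurd ⟨h₁, h₂⟩ hE⟩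
  choose X hX using hX
  let E : ℕ → Set (FreeMonoid A) := fun n =>
    Nat.rec {u₀} (fun _ E => Set.image2 (fun u a => u * inst (X E) a) E Set.univ) n
  have hE : ∀ n, (E n).Finite ∧ E n ⊆ C := by
    intro n
    induction n with
    | zero => exact ⟨Set.finite_singleton _, Set.singleton_subset_iff.2 hu₀⟩
    | succ n ih =>
      refine ⟨ih.1.image2 _ Set.finite_univ, ?_⟩
      rintro _ ⟨u, hu, a, -, rfl⟩
      exact hX _ ih.1 ih.2 u hu a
  let e : List A → FreeMonoid A := fun w =>
    u₀ * (w.zipIdx.map fun r => inst (X (E r.2)) r.1).prod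
  have he : ∀ w a, e (w ++ [a]) = e w * inst (X (E w.length)) a := by
    intro w a
    simp [e, List.zipIdx_append, mul_assoc]
  refine ⟨k, e, fun n => X (E n), he, fun w => ?_⟩
  have hmem : e w ∈ E w.length := by
    induction w using List.reverseRecOn with
    | nil => exact mul_one u₀
    | append_singleton w a ih =>
      rw [he, List.length_append]
      exact ⟨_, ih, a, Set.mem_univ _, rfl⟩
  exact ((hE _).2 hmem).1

end CarlsonSimpson

section StrongEmbedding

variable {I : Type} {α : I → Type}

/-- Families of maps `ψ i` on words over `α i` whose ranges form a vector strong subtree: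
words of the same length are mapped to words of the same length, and `ψ i (u ⌢ a)`
extends `ψ i u ⌢ a`. -/
def IsVecEmb (ψ : ∀ i, List (α i) → List (α i)) : Prop :=
  (∃ lev : ℕ → ℕ, ∀ i u, (ψ i u).length = lev u.length) ∧
    ∀ i u a, ψ i u ++ [a] <+: ψ i (u ++ [a])

/-- The Halpern–Läuchli theorem for products of trees of words. -/
theorem halpern_lauchli [Finite I] [∀ i, Finite (α i)] [∀ i, Nonempty (α i)]
    {κ : Type*} [Finite κ] (c : (∀ i, List (α i)) → κ) :
    ∃ ζ : ∀ i, List (α i) → List (α i), IsVecEmb ζ ∧ ∃ k, ∀ n, ∀ v : ∀ i, List (α i),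
      (∀ i, (v i).length = n) → c (fun i => ζ i (v i)) = k := by
  classical
  obtain ⟨k, e', x', he', hk⟩ := carlson_simpson (A := ∀ i, α i)
    fun w => c fun i => w.toList.map fun a => a i
  let e : List (∀ i, α i) → List (∀ i, α i) := fun w => (e' w).toList
  let x : ℕ → List (Option (∀ i, α i)) := fun n => (x' n).toList
  have he : ∀ w a, e (w ++ [a]) = e w ++ a :: (x w.length).map fun o => o.getD a := by
    intro w a
    simp [e, x, he', subst]
  let a₀ : ∀ i, α i := fun i => Classical.arbitrary _
  have hproj : ∀ i (w w' : List (∀ i, α i)), (w.map fun a => a i) = (w'.map fun a => a i) →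
      ((e w).map fun a => a i) = ((e w').map fun a => a i) := by
    intro i w
    induction w using List.reverseRecOn with
    | nil =>
      intro w' h
      rw [List.map_nil, eq_comm, List.map_eq_nil_iff] at h
      rw [h]
    | append_singleton w a ih =>
      intro w' h
      rcases List.eq_nil_or_concat' w' with rfl | ⟨w', a', rfl⟩
      · simp at h
      · rw [List.map_append, List.map_append] at h
        obtain ⟨h₁, h₂⟩ := List.append_inj' h rfl
        have hlen : w.length = w'.length := by simpa using congrArg List.length h₁
        have haa : a i = a' i := by simpa using h₂
        rw [he, he, List.map_append, List.map_append, ih _ h₁, hlen, List.map_cons,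
          List.map_cons, haa, List.map_map, List.map_map]
        congr 2
        refine List.map_congr_left fun o _ => ?_
        cases o <;> simp [haa]
  let up : ∀ i, List (α i) → List (∀ i, α i) := fun i v => v.map fun a => Function.update a₀ i a
  have hup : ∀ i v, ((up i v).map fun a => a i) = v := by
    intro i v
    simp [up, Function.comp_def]
  have hlen : ∀ w w', w.length = w'.length → (e w).length = (e w').length := by
    intro w
    induction w using List.reverseRecOn with
    | nil =>
      intro w' h
      rw [List.length_nil, eq_comm, List.length_eq_zero_iff] at h
      rw [h]
    | append_singleton w a ih =>
      intro w' h
      rcases List.eq_nil_or_concat' w' with rfl | ⟨w', a', rfl⟩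
      · simp at h
      · have hl : w.length = w'.length := by simpa using h
        rw [he, he, List.length_append, List.length_append, ih _ hl, hl]
        simp
  refine ⟨fun i v => (e (up i v)).map fun a => a i,
    ⟨⟨fun n => (e (List.replicate n a₀)).length, fun i u => ?_⟩, fun i u a => ?_⟩, k,
    fun n v hv => ?_⟩
  · rw [List.length_map]
    exact hlen _ _ (by simp [up])
  · have : up i (u ++ [a]) = up i u ++ [Function.update a₀ i a] := by simp [up]
    simp only [this, he, List.map_append, List.map_cons, Function.update_self]
    exact ⟨_, by rw [List.append_assoc]; rfl⟩
  · let w : List (∀ i, α i) := List.ofFn fun (j : Fin n) i => (v i)[j]'(by rw [hv i]; exact j.2)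
    have hw : ∀ i, (w.map fun a => a i) = v i := by
      intro i
      refine List.ext_getElem (by simp [w, hv]) fun m h₁ h₂ => ?_
      simp [w]
    rw [← hk w]
    congr 1
    funext i
    exact hproj i _ _ (by rw [hup, hw])

end StrongEmbedding

section Fusion

variable {I : Type} {α : I → Type}

theorem IsVecEmb.mono {ψ : ∀ i, List (α i) → List (α i)} (hψ : IsVecEmb ψ) {i : I}
    {u v : List (α i)} (h : u <+: v) : ψ i u <+: ψ i v := by
  obtain ⟨t, rfl⟩ := h
  induction t using List.reverseRecOn with
  | nil => rw [List.append_nil]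
  | append_singleton t a ih =>
    rw [← List.append_assoc]
    exact ih.trans ((List.prefix_append _ _).trans (hψ.2 i _ a))

theorem IsVecEmb.comp {ψ θ : ∀ i, List (α i) → List (α i)} (hψ : IsVecEmb ψ) (hθ : IsVecEmb θ) :
    IsVecEmb fun i u => ψ i (θ i u) := by
  obtain ⟨⟨p, hp⟩, hp'⟩ := hψ
  obtain ⟨⟨t, ht⟩, ht'⟩ := hθ
  exact ⟨⟨fun n => p (t n), fun i u => by rw [hp, ht]⟩,
    fun i u a => (hp' i _ a).trans (IsVecEmb.mono ⟨⟨p, hp⟩, hp'⟩ (ht' i u a))⟩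

/-- `u` and `g` are the root and the top level of a vector fan: all the words `u i` have length
`k`, and `g i a` is a word of length `n` extending `u i ⌢ a`. -/
def IsFan (u : ∀ i, List (α i)) (g : ∀ i, α i → List (α i)) (k n : ℕ) : Prop :=
  (∀ i, (u i).length = k) ∧ ∀ i a, u i ++ [a] <+: g i a ∧ (g i a).length = n

theorem IsFan.succ_le {u : ∀ i, List (α i)} {g : ∀ i, α i → List (α i)} {k n : ℕ}
    (h : IsFan u g k n) (i : I) (a : α i) : k + 1 ≤ n := by
  simpa [h.1 i, (h.2 i a).2] using (h.2 i a).1.length_le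

theorem IsFan.getElem {u : ∀ i, List (α i)} {g : ∀ i, α i → List (α i)} {k n : ℕ}
    (h : IsFan u g k n) (i : I) (a : α i) (hk : k < (g i a).length) : (g i a)[k] = a := by
  obtain ⟨t, ht⟩ := (h.2 i a).1
  obtain rfl := h.1 i
  simp [← ht]

variable {ι κ : Type*}

/-- The colour `c u g₀ w` is constant along `ψ` on the fans with root `u` whose top level
extends `g₀`, whenever `g₀` lies on level `n + 1`. -/
def HomAt (c : (∀ i, List (α i)) → (∀ i, α i → List (α i)) → ι → (∀ i, α i → List (α i)) → κ)
    (Ω : (∀ i, List (α i)) → Set ι) (n : ℕ) (ψ : ∀ i, List (α i) → List (α i)) : Prop :=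
  ∀ k u g₀, IsFan u g₀ k (n + 1) → ∀ w ∈ Ω (fun i => ψ i (u i)), ∀ n₁ n₂ g₁ g₂,
    IsFan u g₁ k n₁ → IsFan u g₂ k n₂ →
    (∀ i a, g₀ i a <+: g₁ i a) → (∀ i a, g₀ i a <+: g₂ i a) →
    c u g₀ w (fun i a => ψ i (g₁ i a)) = c u g₀ w (fun i a => ψ i (g₂ i a))

variable {c : (∀ i, List (α i)) → (∀ i, α i → List (α i)) → ι → (∀ i, α i → List (α i)) → κ}
  {Ω : (∀ i, List (α i)) → Set ι} {ψ θ : ∀ i, List (α i) → List (α i)} {n : ℕ}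

theorem HomAt.comp [∀ i, Nonempty (α i)] (h : HomAt c Ω n ψ) (hθ : IsVecEmb θ)
    (hfix : ∀ i u, u.length ≤ n + 1 → θ i u = u) : HomAt c Ω n fun i u => ψ i (θ i u) := by
  intro k u g₀ hg₀ w hw n₁ n₂ g₁ g₂ hg₁ hg₂ h₁ h₂
  have hu : (fun i => ψ i (θ i (u i))) = fun i => ψ i (u i) := by
    funext i
    have := hg₀.succ_le i (Classical.arbitrary _)
    rw [hfix i (u i) (by rw [hg₀.1 i]; omega)]
  rw [hu] at hw
  have key : ∀ g : ∀ i, α i → List (α i), (∀ i a, g₀ i a <+: g i a) →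
      ∀ i a, g₀ i a <+: θ i (g i a) := by
    intro g hg i a
    have := hθ.mono (hg i a)
    rwa [hfix i (g₀ i a) (hg₀.2 i a).2.le] at this
  have hfan : ∀ (g : ∀ i, α i → List (α i)) (m : ℕ), IsFan u g k m → (∀ i a, g₀ i a <+: g i a) →
      IsFan u (fun i a => θ i (g i a)) k (hθ.1.choose m) := fun g m hg hgg =>
    ⟨hg.1, fun i a => ⟨(hg₀.2 i a).1.trans (key g hgg i a), by
      rw [hθ.1.choose_spec, (hg.2 i a).2]⟩⟩
  exact h k u g₀ hg₀ w hw _ _ _ _ (hfan g₁ n₁ hg₁ h₁) (hfan g₂ n₂ hg₂ h₂) (key g₁ h₁) (key g₂ h₂)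

theorem finite_pi_list_length_le [Finite I] [∀ i, Finite (α i)] (n : ℕ) :
    {u : ∀ i, List (α i) | ∀ i, (u i).length ≤ n}.Finite := by
  have := Set.Finite.pi' fun i => List.finite_length_le (α i) n
  exact this

theorem finite_fan_tops [Finite I] [∀ i, Finite (α i)] (n : ℕ) :
    {g : ∀ i, α i → List (α i) | ∀ i a, (g i a).length ≤ n}.Finite := by
  have := Set.Finite.pi' fun i => Set.Finite.pi' fun _ : α i => List.finite_length_le (α i) n
  exact this

/-- Embeddings of the trees above the words of length `n + 1` are glued to an embedding that
fixes the words of length at most `n`. -/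
theorem exists_homAt_comp [Finite I] [∀ i, Finite (α i)] [∀ i, Nonempty (α i)] [Finite κ]
    (c : (∀ i, List (α i)) → (∀ i, α i → List (α i)) → ι → (∀ i, α i → List (α i)) → κ)
    (hΩ : ∀ u, (Ω u).Finite) (ψ : ∀ i, List (α i) → List (α i)) (n : ℕ) :
    ∃ θ : ∀ i, List (α i) → List (α i), IsVecEmb θ ∧ (∀ i u, u.length ≤ n → θ i u = u) ∧
      HomAt c Ω n fun i u => ψ i (θ i u) := by
  classical
  let J : Set (((∀ i, List (α i)) × ι) × (∀ i, α i → List (α i))) :=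
    {s | (∀ i, (s.1 i).length ≤ n) ∧ s.2 ∈ Ω (fun i => ψ i (s.1 i))} ×ˢ
      {g | ∀ i a, (g i a).length ≤ n + 1}
  have hJ : J.Finite := by
    refine Set.Finite.prod ?_ (finite_fan_tops (n + 1))
    refine ((finite_pi_list_length_le n).biUnion fun u _ =>
      (hΩ fun i => ψ i (u i)).image (Prod.mk u)).subset fun s hs => ?_
    exact Set.mem_biUnion hs.1 ⟨s.2, hs.2, rfl⟩
  have : Finite J := hJ
  let I' : Type := Σ i, {s : List (α i) // s.length = n + 1}
  have : ∀ i, Finite {s : List (α i) // s.length = n + 1} := fun i =>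
    List.finite_length_eq (α i) (n + 1)
  have : Finite I' := inferInstanceAs (Finite (Σ i, {s : List (α i) // s.length = n + 1}))
  let at' (v : ∀ j : I', List (α j.1)) (i : I) (s : List (α i)) : List (α i) :=
    if h : s.length = n + 1 then v ⟨i, s, h⟩ else []
  obtain ⟨ζ, hζ, K, hK⟩ := halpern_lauchli (I := I') (α := fun j => α j.1) (κ := J → κ)
    fun v s => c s.1.1.1 s.1.2 s.1.1.2 fun i a => ψ i (s.1.2 i a ++ at' v i (s.1.2 i a))
  let θ : ∀ i, List (α i) → List (α i) := fun i u =>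
    if h : u.length ≤ n then u
    else u.take (n + 1) ++ ζ ⟨i, u.take (n + 1), by simp; omega⟩ (u.drop (n + 1))
  have hfix : ∀ i u, u.length ≤ n → θ i u = u := fun i u hu => dif_pos hu
  have happ : ∀ i (s : List (α i)) (hs : s.length = n + 1) (t : List (α i)),
      θ i (s ++ t) = s ++ ζ ⟨i, s, hs⟩ t := by
    intro i s hs t
    have hlen : ¬ (s ++ t).length ≤ n := by simp; omega
    have htake : (s ++ t).take (n + 1) = s := List.take_left' hs
    have hdrop : (s ++ t).drop (n + 1) = t := List.drop_left' hs
    have hcongr : ∀ (s' : List (α i)) (hs' : s'.length = n + 1), s' = s →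
        (ζ ⟨i, s', hs'⟩ : List (α i) → List (α i)) = ζ ⟨i, s, hs⟩ := by
      rintro _ _ rfl
      rfl
    simp only [θ, dif_neg hlen, hdrop]
    rw [hcongr _ _ htake, htake]
  refine ⟨θ, ⟨?_, ?_⟩, hfix, ?_⟩
  · obtain ⟨lev, hlev⟩ := hζ.1
    refine ⟨fun m => if m ≤ n then m else n + 1 + lev (m - (n + 1)), fun i u => ?_⟩
    by_cases hu : u.length ≤ n
    · simp [hfix i u hu, hu]
    · simp only [θ, dif_neg hu, if_neg hu, List.length_append, hlev, List.length_take,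
        List.length_drop]
      omega
  · intro i u a
    rcases lt_trichotomy u.length n with hu | hu | hu
    · rw [hfix i u hu.le, hfix i (u ++ [a]) (by simp; omega)]
    · have := happ i (u ++ [a]) (by simp; omega) []
      rw [List.append_nil] at this
      rw [hfix i u hu.le, this]
      exact List.prefix_append _ _
    · have hs : (u.take (n + 1)).length = n + 1 := by simp; omega
      obtain ⟨t, ht⟩ : ∃ t, u = u.take (n + 1) ++ t := ⟨_, (List.take_append_drop (n + 1) u).symm⟩
      rw [ht, List.append_assoc, happ i _ hs, happ i _ hs, List.append_assoc,
        List.prefix_append_right_inj]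
      exact hζ.2 ⟨i, _, hs⟩ t a
  · intro k u g₀ hg₀ w hw n₁ n₂ g₁ g₂ hg₁ hg₂ h₁ h₂
    have hk : ∀ i, k ≤ n := fun i => by
      have := hg₀.succ_le i (Classical.arbitrary _)
      omega
    have hu : (fun i => ψ i (θ i (u i))) = fun i => ψ i (u i) := by
      funext i
      rw [hfix i (u i) ((hg₀.1 i).trans_le (hk i))]
    rw [hu] at hw
    have hmem : (⟨⟨u, w⟩, g₀⟩ : ((∀ i, List (α i)) × ι) × (∀ i, α i → List (α i))) ∈ J :=
      ⟨⟨fun i => (hg₀.1 i).trans_le (hk i), hw⟩, fun i a => (hg₀.2 i a).2.le⟩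
    have key : ∀ (g : ∀ i, α i → List (α i)) (m : ℕ), IsFan u g k m →
        (∀ i a, g₀ i a <+: g i a) →
        c u g₀ w (fun i a => ψ i (θ i (g i a))) = K ⟨_, hmem⟩ := by
      intro g m hg hgg
      let v : ∀ j : I', List (α j.1) := fun j =>
        (g j.1 (j.2.1[k]'(by rw [j.2.2]; have := hk j.1; omega))).drop (n + 1)
      have hv := congrFun (hK (m - (n + 1)) v fun j => by simp [v, (hg.2 _ _).2]) ⟨_, hmem⟩
      rw [← hv]
      congr 1
      funext i a
      congr 1
      obtain ⟨t, ht⟩ := hgg i a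
      have hva : v ⟨i, g₀ i a, (hg₀.2 i a).2⟩ = t := by
        simp only [v, hg₀.getElem i a]
        rw [← ht, List.drop_left' (hg₀.2 i a).2]
      simp only [at', dif_pos (hg₀.2 i a).2]
      rw [hva, ← ht, happ i _ (hg₀.2 i a).2]
    rw [key g₁ n₁ hg₁ h₁, key g₂ n₂ hg₂ h₂]

/-- A Milliken-type theorem for fans: for all finite colourings simultaneously, the colour of a
fan above `g₀` depends on `g₀` only. -/
theorem exists_homAt [Finite I] [∀ i, Finite (α i)] [∀ i, Nonempty (α i)] [Finite κ]
    (c : (∀ i, List (α i)) → (∀ i, α i → List (α i)) → ι → (∀ i, α i → List (α i)) → κ)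
    (hΩ : ∀ u, (Ω u).Finite) :
    ∃ ψ : ∀ i, List (α i) → List (α i), IsVecEmb ψ ∧ ∀ n, HomAt c Ω n ψ := by
  choose θ hθ hfix hhom using fun ψ n => exists_homAt_comp c hΩ ψ n
  let Ψ : ℕ → ∀ i, List (α i) → List (α i) := fun n =>
    Nat.rec (fun _ u => u) (fun n ψ i u => ψ i (θ ψ n i u)) n
  have hΨ : ∀ n, IsVecEmb (Ψ n) := by
    intro n
    induction n with
    | zero => exact ⟨⟨id, fun _ _ => rfl⟩, fun _ _ _ => List.prefix_rfl⟩
    | succ n ih => exact ih.comp (hθ (Ψ n) n)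
  have hstab : ∀ i u m, u.length ≤ m → Ψ m i u = Ψ u.length i u := by
    intro i u m hm
    induction m, hm using Nat.le_induction with
    | base => rfl
    | succ m hm ih => exact (congrArg (Ψ m i) (hfix (Ψ m) m i u hm)).trans ih
  have hH : ∀ n m, n + 1 ≤ m → HomAt c Ω n (Ψ m) := by
    intro n m hm
    induction m, hm using Nat.le_induction with
    | base => exact hhom (Ψ n) n
    | succ m hm ih =>
      exact ih.comp (hθ (Ψ m) m) fun i u hu => hfix (Ψ m) m i u (hu.trans hm)
  refine ⟨fun i u => Ψ u.length i u, ⟨⟨fun m => (hΨ m).1.choose m, fun i u => ?_⟩,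
    fun i u a => ?_⟩, fun n k u g₀ hg₀ w hw n₁ n₂ g₁ g₂ hg₁ hg₂ h₁ h₂ => ?_⟩
  · exact (hΨ _).1.choose_spec i u
  · have := (hΨ (u ++ [a]).length).2 i u a
    rwa [hstab i u _ (by simp)] at this
  · let N := max (n + 1) (max n₁ n₂)
    have e₁ : ∀ i a, Ψ (g₁ i a).length i (g₁ i a) = Ψ N i (g₁ i a) := fun i a =>
      (hstab i _ N (by rw [(hg₁.2 i a).2]; omega)).symm
    have e₂ : ∀ i a, Ψ (g₂ i a).length i (g₂ i a) = Ψ N i (g₂ i a) := fun i a =>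
      (hstab i _ N (by rw [(hg₂.2 i a).2]; omega)).symm
    have e₀ : (fun i => Ψ (u i).length i (u i)) = fun i => Ψ N i (u i) := by
      funext i
      have := hg₀.succ_le i (Classical.arbitrary _)
      exact (hstab i _ N (by rw [hg₀.1 i]; omega)).symm
    simp only [e₁, e₂]
    exact hH n N (le_max_left _ _) k u g₀ hg₀ w (by rwa [← e₀]) n₁ n₂ g₁ g₂ hg₁ hg₂ h₁ h₂

end Fusion

section TreeEmbedding

theorem exists_append_singleton_prefix {β : Type*} {u v : List β} (h : u <+: v) (hne : u ≠ v) :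
    ∃ a, u ++ [a] <+: v := by
  obtain ⟨t, rfl⟩ := h
  cases t with
  | nil => simp at hne
  | cons a t => exact ⟨a, t, by simp⟩

theorem eq_of_append_singleton_prefix {β : Type*} {u v : List β} {a a' : β}
    (h : u ++ [a] <+: v) (h' : u ++ [a'] <+: v) : a = a' := by
  have := (List.prefix_of_prefix_length_le h h' (by simp)).eq_of_length (by simp)
  simpa using this

theorem prefix_antisymm {β : Type*} {u v : List β} (h : u <+: v) (h' : v <+: u) : u = v :=
  h.eq_of_length (le_antisymm h.length_le h'.length_le)

theorem ncard_strict_prefixes {β : Type*} (u : List β) :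
    {v | v <+: u ∧ v ≠ u}.ncard = u.length := by
  have h : {v | v <+: u ∧ v ≠ u} = (fun k => u.take k) '' Set.Iio u.length := by
    ext v
    constructor
    · rintro ⟨hv, hne⟩
      refine ⟨v.length, ?_, (List.prefix_iff_eq_take.1 hv).symm⟩
      exact lt_of_le_of_ne hv.length_le fun h => hne (hv.eq_of_length h)
    · rintro ⟨k, hk, rfl⟩
      refine ⟨List.take_prefix _ _, fun h => ?_⟩
      have := congrArg List.length h
      simp only [List.length_take, Set.mem_Iio] at this hk
      omega
  rw [h, Set.InjOn.ncard_image, Set.ncard_Iio_nat]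
  intro k hk k' hk' h
  have := congrArg List.length h
  simp only [List.length_take, Set.mem_Iio] at this hk hk'
  omega

variable {b : ℕ} {φ : List (Fin b) → List ℕ} {lev : ℕ → ℕ}

/-- `φ` maps the tree of words over `Fin b` onto a homogeneous tree with level set given
by `lev`. -/
def IsTreeEmb (φ : List (Fin b) → List ℕ) (lev : ℕ → ℕ) : Prop :=
  (∀ u, (φ u).length = lev u.length) ∧ ∀ u (q : Fin b), φ u ++ [q.val] <+: φ (u ++ [q])

theorem IsTreeEmb.mono (h : IsTreeEmb φ lev) {u v : List (Fin b)} (huv : u <+: v) :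
    φ u <+: φ v := by
  obtain ⟨t, rfl⟩ := huv
  induction t using List.reverseRecOn with
  | nil => rw [List.append_nil]
  | append_singleton t a ih =>
    rw [← List.append_assoc]
    exact ih.trans ((List.prefix_append _ _).trans (h.2 _ a))

theorem IsTreeEmb.prefix_iff (h : IsTreeEmb φ lev) {u v : List (Fin b)} :
    φ u <+: φ v ↔ u <+: v := by
  refine ⟨fun huv => ?_, h.mono⟩
  induction u using List.reverseRecOn with
  | nil => exact List.nil_prefix
  | append_singleton u q ih =>
    have hu : u <+: v := ih ((List.prefix_append _ _).trans ((h.2 u q).trans huv))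
    have hq : φ u ++ [q.val] <+: φ v := (h.2 u q).trans huv
    obtain ⟨q', hq'⟩ := exists_append_singleton_prefix hu (by
      rintro rfl
      simpa using hq.length_le)
    have := eq_of_append_singleton_prefix hq ((h.2 u q').trans (h.mono hq'))
    rwa [Fin.ext this]

theorem IsTreeEmb.injective (h : IsTreeEmb φ lev) : Function.Injective φ := fun u v huv =>
  prefix_antisymm (h.prefix_iff.1 (by rw [huv])) (h.prefix_iff.1 (by rw [huv]))

theorem IsTreeEmb.mem_level_iff (h : IsTreeEmb φ lev) {n : ℕ} {t : List ℕ} :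
    t ∈ level (Set.range φ) n ↔ ∃ u, u.length = n ∧ φ u = t := by
  have key : ∀ u, {s ∈ Set.range φ | s <+: φ u ∧ s ≠ φ u}.ncard = u.length := by
    intro u
    have : {s ∈ Set.range φ | s <+: φ u ∧ s ≠ φ u} = φ '' {v | v <+: u ∧ v ≠ u} := by
      ext s
      constructor
      · rintro ⟨⟨v, rfl⟩, h₁, h₂⟩
        exact ⟨v, ⟨h.prefix_iff.1 h₁, fun e => h₂ (by rw [e])⟩, rfl⟩
      · rintro ⟨v, ⟨h₁, h₂⟩, rfl⟩
        exact ⟨⟨v, rfl⟩, h.mono h₁, fun e => h₂ (h.injective e)⟩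
    rw [this, Set.ncard_image_of_injective _ h.injective, ncard_strict_prefixes]
  constructor
  · rintro ⟨⟨u, rfl⟩, hu⟩
    exact ⟨u, by rw [← hu, key], rfl⟩
  · rintro ⟨u, rfl, rfl⟩
    exact ⟨⟨u, rfl⟩, key u⟩

theorem IsTreeEmb.immSuc_iff (h : IsTreeEmb φ lev) {u : List (Fin b)} {t : List ℕ} :
    ImmSuc (Set.range φ) (φ u) t ↔ ∃ q, φ (u ++ [q]) = t := by
  constructor
  · rintro ⟨-, ⟨v, rfl⟩, huv, hne, hmin⟩
    obtain ⟨q, hq⟩ := exists_append_singleton_prefix (h.prefix_iff.1 huv) fun e => hne (by rw [e])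
    refine ⟨q, (hmin _ ⟨_, rfl⟩ (h.mono (List.prefix_append _ _)) (h.mono hq)).resolve_left ?_⟩
    intro e
    simpa using h.injective e
  · rintro ⟨q, rfl⟩
    refine ⟨⟨_, rfl⟩, ⟨_, rfl⟩, h.mono (List.prefix_append _ _), fun e => ?_, ?_⟩
    · simpa using h.injective e
    · rintro _ ⟨v, rfl⟩ h₁ h₂
      rw [h.prefix_iff] at h₁ h₂
      have l₁ := h₁.length_le
      have l₂ := h₂.length_le
      rw [List.length_append, List.length_singleton] at l₂
      rcases Nat.lt_or_ge u.length v.length with hlt | hge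
      · exact Or.inr (by rw [h₂.eq_of_length (by simp; omega)])
      · exact Or.inl (by rw [h₁.eq_of_length (by omega)])

theorem isTreeEmb_map_val : IsTreeEmb (List.map (Fin.val : Fin b → ℕ)) id :=
  ⟨fun _ => List.length_map _, fun u q => by simp⟩

theorem range_map_val : Set.range (List.map (Fin.val : Fin b → ℕ)) = bSeq b := by
  ext t
  simp only [bSeq, Set.mem_range, Set.mem_ofPred_eq]
  constructor
  · rintro ⟨u, rfl⟩ x hx
    obtain ⟨q, -, rfl⟩ := List.mem_map.1 hx
    exact q.2
  · intro ht
    exact ⟨t.pmap (fun x hx => ⟨x, hx⟩) ht, by simp [List.map_pmap]⟩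

theorem IsTreeEmb.comp (h : IsTreeEmb φ lev) {ψ : List (Fin b) → List (Fin b)} {m : ℕ → ℕ}
    (hlen : ∀ u, (ψ u).length = m u.length) (hψ : ∀ u q, ψ u ++ [q] <+: ψ (u ++ [q])) :
    IsTreeEmb (fun u => φ (ψ u)) fun n => lev (m n) :=
  ⟨fun u => by rw [h.1, hlen], fun u q => (h.2 _ q).trans (h.mono (hψ u q))⟩

theorem IsTreeEmb.uniquelyRooted (h : IsTreeEmb φ lev) : UniquelyRooted (Set.range φ) := by
  refine ⟨φ [], h.mem_level_iff.2 ⟨[], rfl, rfl⟩, fun t ht => ?_⟩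
  obtain ⟨u, hu, rfl⟩ := h.mem_level_iff.1 ht
  rw [List.length_eq_zero_iff.1 hu]

theorem IsTreeEmb.isStrongSubtreeWith (h : IsTreeEmb φ lev) (hb : 0 < b)
    {ψ : List (Fin b) → List (Fin b)} {m : ℕ → ℕ} (hlen : ∀ u, (ψ u).length = m u.length)
    (hψ : ∀ u q, ψ u ++ [q] <+: ψ (u ++ [q])) :
    IsStrongSubtreeWith (Set.range φ) (Set.range fun u => φ (ψ u)) m := by
  have h' := h.comp hlen hψ
  refine ⟨?_, h'.uniquelyRooted, ?_, ?_, ?_⟩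
  · rintro _ ⟨u, rfl⟩
    exact ⟨_, rfl⟩
  · refine strictMono_nat_of_lt_succ fun n => ?_
    have := (hψ (List.replicate n ⟨0, hb⟩) ⟨0, hb⟩).length_le
    simpa [hlen] using this
  · intro n t ht
    obtain ⟨u, rfl, rfl⟩ := h'.mem_level_iff.1 ht
    exact h.mem_level_iff.2 ⟨ψ u, hlen u, rfl⟩
  · rintro _ ⟨u, rfl⟩ t ht
    obtain ⟨q, rfl⟩ := h.immSuc_iff.1 ht
    refine ⟨φ (ψ (u ++ [q])), ⟨h'.immSuc_iff.2 ⟨q, rfl⟩, h.mono (hψ u q)⟩, ?_⟩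
    rintro s ⟨hs, hts⟩
    obtain ⟨q', rfl⟩ := h'.immSuc_iff.1 hs
    have := eq_of_append_singleton_prefix (h.prefix_iff.1 hts) (hψ u q')
    rw [this]

theorem isHomogeneous_bSeq (hb : 2 ≤ b) : IsHomogeneous b (bSeq b) := by
  refine ⟨hb, id, ?_⟩
  have := (isTreeEmb_map_val (b := b)).isStrongSubtreeWith (by omega) (ψ := id) (m := id)
    (fun _ => rfl) fun _ _ => List.prefix_rfl
  simpa only [range_map_val, id] using this

theorem finite_strict_predecessors (T : Set (List ℕ)) (t : List ℕ) :
    {s ∈ T | s <+: t ∧ s ≠ t}.Finite := by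
  refine (List.finite_toSet t.inits).subset fun s hs => ?_
  exact (List.mem_inits _ _).2 hs.2.1

theorem ImmSuc.mem_level_succ {T : Set (List ℕ)} {s t : List ℕ} {n : ℕ} (h : ImmSuc T s t)
    (hs : s ∈ level T n) : t ∈ level T (n + 1) := by
  obtain ⟨hsT, htT, hst, hne, hmin⟩ := h
  have : {r ∈ T | r <+: t ∧ r ≠ t} = insert s {r ∈ T | r <+: s ∧ r ≠ s} := by
    ext r
    constructor
    · rintro ⟨hr, hrt, hne'⟩
      rcases List.prefix_or_prefix_of_prefix hrt hst with hrs | hsr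
      · by_cases e : r = s
        · exact Or.inl e
        · exact Or.inr ⟨hr, hrs, e⟩
      · exact Or.inl ((hmin r hr hsr hrt).resolve_right hne')
    · rintro (rfl | ⟨hr, hrs, hne'⟩)
      · exact ⟨hsT, hst, hne⟩
      · refine ⟨hr, hrs.trans hst, ?_⟩
        rintro rfl
        exact hne' (prefix_antisymm hrs hst)
  refine ⟨htT, ?_⟩
  rw [this, Set.ncard_insert_of_notMem (fun h => h.2.2 rfl) (finite_strict_predecessors T s), hs.2]

/-- Every node that is not minimal is an immediate successor. -/
theorem exists_immSuc_of_level_ne {T : Set (List ℕ)} {t : List ℕ} (ht : t ∈ T)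
    (h0 : t ∉ level T 0) : ∃ s, ImmSuc T s t := by
  have hne : {s ∈ T | s <+: t ∧ s ≠ t}.Nonempty := by
    by_contra hemp
    rw [Set.not_nonempty_iff_eq_empty] at hemp
    exact h0 ⟨ht, by rw [hemp, Set.ncard_empty]⟩
  obtain ⟨s, hs, hmax⟩ :=
    Set.exists_max_image _ List.length (finite_strict_predecessors T t) hne
  refine ⟨s, hs.1, ht, hs.2.1, hs.2.2, fun u hu hsu hut => ?_⟩
  by_cases e : u = t
  · exact Or.inr e
  · have := hmax u ⟨hu, hut, e⟩
    exact Or.inl (hsu.eq_of_length (le_antisymm hsu.length_le this)).symm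

theorem IsStrongSubtreeWith.level_zero {T S : Set (List ℕ)} {l : ℕ → ℕ}
    (h : IsStrongSubtreeWith T S l) : ∃ r, level S 0 = {r} := by
  obtain ⟨r, hr, huniq⟩ := h.2.1
  exact ⟨r, Set.eq_singleton_iff_unique_mem.2 ⟨hr, huniq⟩⟩

theorem exists_isTreeEmb_of_isHomogeneous {T : Set (List ℕ)} (h : IsHomogeneous b T) :
    ∃ (φ : List (Fin b) → List ℕ) (lev : ℕ → ℕ), IsTreeEmb φ lev ∧ Set.range φ = T := by
  obtain ⟨-, l, hl⟩ := h
  obtain ⟨r, hr⟩ := hl.level_zero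
  obtain ⟨hsub, -, -, hlev, hsuc⟩ := hl
  have hsuc' : ∀ s ∈ T, ∀ q : Fin b, ∃! s', ImmSuc T s s' ∧ s ++ [q.val] <+: s' := by
    intro s hs q
    refine hsuc s hs _ ?_
    obtain ⟨u, rfl⟩ := range_map_val.ge (hsub hs)
    rw [← range_map_val, isTreeEmb_map_val.immSuc_iff]
    exact ⟨q, by simp⟩
  choose! next hnext huniq using hsuc'
  have hrT : r ∈ level T 0 := hr ▸ Set.mem_singleton r
  let φ : List (Fin b) → List ℕ := fun u => u.foldl next r
  have hφ : ∀ u q, φ (u ++ [q]) = next (φ u) q := fun u q => by simp [φ]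
  have hmem : ∀ u, φ u ∈ level T u.length := by
    intro u
    induction u using List.reverseRecOn with
    | nil => exact hrT
    | append_singleton u q ih =>
      rw [hφ, List.length_append]
      exact (hnext _ ih.1 q).1.mem_level_succ ih
  refine ⟨φ, l, ⟨fun u => ?_, fun u q => ?_⟩, ?_⟩
  · have := hlev _ (hmem u)
    rw [← range_map_val, isTreeEmb_map_val.mem_level_iff] at this
    obtain ⟨v, hv, hvu⟩ := this
    rw [← hvu, List.length_map, hv]
  · rw [hφ]
    exact (hnext _ (hmem u).1 q).2
  · refine Set.Subset.antisymm (by rintro _ ⟨u, rfl⟩; exact (hmem u).1) fun t ht => ?_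
    induction hn : t.length using Nat.strong_induction_on generalizing t with
    | _ n ih =>
      by_cases h0 : t ∈ level T 0
      · rw [hr] at h0
        exact ⟨[], h0.symm⟩
      · obtain ⟨s, hs⟩ := exists_immSuc_of_level_ne ht h0
        obtain ⟨q, hq⟩ := exists_append_singleton_prefix hs.2.2.1 hs.2.2.2.1
        obtain ⟨u, rfl⟩ := ih s.length (by
          have := hq.length_le
          simp at this
          omega) s hs.1 rfl
        have hqb : q < b := hsub ht q (hq.subset (by simp))
        exact ⟨u ++ [⟨q, hqb⟩], by rw [hφ]; exact (huniq _ hs.1 ⟨q, hqb⟩ t ⟨hs, hq⟩).symm⟩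

/-- The first two levels of a strong subtree of the range of `φ`. -/
theorem IsTreeEmb.exists_fan (h : IsTreeEmb φ lev) {S : Set (List ℕ)} {l : ℕ → ℕ}
    (hS : IsStrongSubtreeWith (Set.range φ) S l) :
    ∃ (u : List (Fin b)) (g : Fin b → List (Fin b)), level S 0 = {φ u} ∧ u.length = l 0 ∧
      level S 1 = Set.range (fun q => φ (g q)) ∧
      ∀ q, u ++ [q] <+: g q ∧ (g q).length = l 1 := by
  obtain ⟨r, hr⟩ := hS.level_zero
  obtain ⟨hsub, -, -, hlev, hsuc⟩ := hS
  have hrS : r ∈ level S 0 := hr ▸ Set.mem_singleton r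
  obtain ⟨u, hu, rfl⟩ := h.mem_level_iff.1 (hlev 0 hrS)
  choose s hs huniq using fun q : Fin b => hsuc (φ u) hrS.1 _ (h.immSuc_iff.2 ⟨q, rfl⟩)
  have hs1 : ∀ q, s q ∈ level S 1 := fun q => (hs q).1.mem_level_succ hrS
  choose g hg hgs using fun q => h.mem_level_iff.1 (hlev 1 (hs1 q))
  refine ⟨u, g, hr, hu, ?_, fun q => ⟨h.prefix_iff.1 (by rw [hgs]; exact (hs q).2), hg q⟩⟩
  refine Set.Subset.antisymm (fun t ht => ?_) (by rintro _ ⟨q, rfl⟩; simp only [hgs]; exact hs1 q)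
  obtain ⟨s', hs'⟩ := exists_immSuc_of_level_ne ht.1 fun h0 => by
    have := h0.2.symm.trans ht.2
    omega
  have hs'0 : s' ∈ level S 0 := by
    refine ⟨hs'.1, ?_⟩
    have := (hs'.mem_level_succ ⟨hs'.1, rfl⟩).2.symm.trans ht.2
    omega
  rw [hr, Set.mem_singleton_iff] at hs'0
  subst hs'0
  obtain ⟨v, rfl⟩ := hsub ht.1
  obtain ⟨q, hq⟩ := exists_append_singleton_prefix (h.prefix_iff.1 hs'.2.2.1)
    fun e => hs'.2.2.2.1 (by rw [e])
  exact ⟨q, (hgs q).trans (huniq q _ ⟨hs', h.mono hq⟩).symm⟩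

/-- The levels of a fan. -/
theorem IsTreeEmb.fan_levels (h : IsTreeEmb φ lev) {u : List (Fin b)} {g : Fin b → List (Fin b)}
    {n : ℕ} (hg : ∀ q, u ++ [q] <+: g q ∧ (g q).length = n) {F : Set (List ℕ)}
    (hF : F = {φ u} ∪ Set.range fun q => φ (g q)) :
    φ u ∈ level F 0 ∧ level F 1 = Set.range fun q => φ (g q) := by
  have hne : ∀ q, φ u ≠ φ (g q) := fun q e => by
    have := (hg q).1.length_le
    rw [← h.injective e] at this
    simp at this
  have hug : ∀ q, φ u <+: φ (g q) := fun q => h.mono ((List.prefix_append _ _).trans (hg q).1)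
  have hroot : {s ∈ F | s <+: φ u ∧ s ≠ φ u} = ∅ := by
    refine Set.eq_empty_iff_forall_notMem.2 ?_
    rintro s ⟨hs, hsu, hne'⟩
    rw [hF] at hs
    rcases hs with rfl | ⟨q, rfl⟩
    · exact hne' rfl
    · exact hne' (prefix_antisymm hsu (hug q))
  have htop : ∀ q, {s ∈ F | s <+: φ (g q) ∧ s ≠ φ (g q)} = {φ u} := by
    intro q
    refine Set.eq_singleton_iff_unique_mem.2 ⟨⟨hF ▸ Or.inl rfl, hug q, hne q⟩, ?_⟩
    rintro s ⟨hs, hsg, hne'⟩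
    rw [hF] at hs
    rcases hs with rfl | ⟨q', rfl⟩
    · rfl
    · exact absurd (hsg.eq_of_length (by rw [h.1, h.1, (hg q).2, (hg q').2])) hne'
  refine ⟨⟨hF ▸ Or.inl rfl, by rw [hroot, Set.ncard_empty]⟩, ?_⟩
  ext t
  constructor
  · rintro ⟨ht, hcard⟩
    rw [hF] at ht
    rcases ht with rfl | ht
    · rw [hroot, Set.ncard_empty] at hcard
      omega
    · exact ht
  · rintro ⟨q, rfl⟩
    exact ⟨hF ▸ Or.inr ⟨q, rfl⟩, by simp only [htop, Set.ncard_singleton]⟩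

end TreeEmbedding

section Probability

open MeasureTheory

variable {d : ℕ} {b : Fin d → ℕ}

/-- The tuple of words with digits `t`, viewed as a tuple of sequences of natural numbers. -/
def digits (b : Fin d → ℕ) (n : ℕ) (t : ∀ i, Fin n → Fin (b i)) : Fin d → List ℕ :=
  fun i => (List.ofFn (t i)).map Fin.val

theorem digits_injective (n : ℕ) : Function.Injective (digits b n) := by
  intro t t' h
  funext i
  exact List.ofFn_injective (isTreeEmb_map_val.injective (congrFun h i))

theorem mem_vecLevel_bSeq_iff {n : ℕ} {v : Fin d → List ℕ} :
    v ∈ vecLevel (fun i => bSeq (b i)) n ↔ ∃ t, digits b n t = v := by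
  constructor
  · intro hv
    have : ∀ i, ∃ u : List (Fin (b i)), u.length = n ∧ u.map Fin.val = v i := fun i => by
      have : v i ∈ level (bSeq (b i)) n := hv i
      rwa [← range_map_val, isTreeEmb_map_val.mem_level_iff] at this
    choose u hu huv using this
    refine ⟨fun i k => (u i).get (k.cast (hu i).symm), funext fun i => ?_⟩
    rw [← huv i]
    refine congrArg (List.map Fin.val) (List.ext_get (by simp [hu]) ?_)
    intro k h₁ h₂
    simp
  · rintro ⟨t, rfl⟩ i
    change _ ∈ level (bSeq (b i)) n
    rw [← range_map_val, isTreeEmb_map_val.mem_level_iff]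
    exact ⟨List.ofFn (t i), List.length_ofFn, rfl⟩

variable {Ω : Type*} {A : (∀ i, List (Fin (b i))) → Set Ω}

open Classical in
/-- The proportion of the tuples of words of length `n` whose event contains `x`. -/
noncomputable def hitDensity (A : (∀ i, List (Fin (b i))) → Set Ω) (n : ℕ) (x : Ω) : ℝ :=
  (∑ t : ∀ i, Fin n → Fin (b i), (A fun i => List.ofFn (t i)).indicator 1 x) /
    Fintype.card (∀ i, Fin n → Fin (b i))

theorem hitDensity_nonneg (n : ℕ) (x : Ω) : 0 ≤ hitDensity A n x :=
  div_nonneg (Finset.sum_nonneg fun _ _ => Set.indicator_nonneg (fun _ _ => zero_le_one) _)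
    (Nat.cast_nonneg _)

theorem hitDensity_le_one (n : ℕ) (x : Ω) : hitDensity A n x ≤ 1 := by
  refine div_le_one_of_le₀ ?_ (Nat.cast_nonneg _)
  refine (Finset.sum_le_card_nsmul _ _ 1 fun t _ => ?_).trans (by simp)
  exact Set.indicator_le_self' (fun _ _ => zero_le_one) _ |>.trans (by simp)

theorem exists_fan_of_not_tendsto (hDHL : DHL d) (hb : ∀ i, 2 ≤ b i) {x : Ω}
    (hx : ¬ Tendsto (fun n => hitDensity A n x) atTop (nhds 0)) :
    ∃ u g, (∃ k n, IsFan u g k n) ∧ x ∈ A u ∧ ∀ a : ∀ i, Fin (b i), x ∈ A fun i => g i (a i) := by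
  classical
  let T : Fin d → Set (List ℕ) := fun i => bSeq (b i)
  let D : Set (Fin d → List ℕ) :=
    {v | ∃ u : ∀ i, List (Fin (b i)), (fun i => (u i).map Fin.val) = v ∧ x ∈ A u} ∩ levelProd T
  have hmem : ∀ u : ∀ i, List (Fin (b i)), (fun i => (u i).map Fin.val) ∈ D → x ∈ A u := by
    rintro u ⟨⟨u', hu', hx'⟩, -⟩
    have : u' = u := funext fun i => isTreeEmb_map_val.injective (congrFun hu' i)
    rwa [← this]
  have hdens : ∀ n, hitDensity A n x = ((D ∩ vecLevel T n).ncard : ℝ) / (vecLevel T n).ncard := by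
    intro n
    have h₁ : vecLevel T n = Set.range (digits b n) :=
      Set.ext fun v => mem_vecLevel_bSeq_iff
    have h₂ : D ∩ vecLevel T n = digits b n '' {t | x ∈ A fun i => List.ofFn (t i)} := by
      ext v
      constructor
      · rintro ⟨hv, hv'⟩
        obtain ⟨t, rfl⟩ := mem_vecLevel_bSeq_iff.1 hv'
        exact ⟨t, hmem _ hv, rfl⟩
      · rintro ⟨t, ht, rfl⟩
        have : digits b n t ∈ vecLevel T n := mem_vecLevel_bSeq_iff.2 ⟨t, rfl⟩
        exact ⟨⟨⟨_, rfl, ht⟩, Set.mem_iUnion.2 ⟨n, this⟩⟩, this⟩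
    rw [h₂, h₁, ← Set.image_univ, Set.ncard_image_of_injective _ (digits_injective n),
      Set.ncard_image_of_injective _ (digits_injective n), Set.ncard_univ, Nat.card_eq_fintype_card,
      hitDensity]
    congr 1
    simp only [Set.indicator_apply, Pi.one_apply, Finset.sum_boole]
    rw [Set.ncard_eq_toFinset_card', Set.toFinset_ofPred]
  have hlim : 0 < limsup (fun n => hitDensity A n x) atTop := by
    by_contra hle
    refine hx (tendsto_of_le_liminf_of_limsup_le ?_ (not_lt.1 hle) ?_ ?_)
    · exact le_liminf_of_le (isCoboundedUnder_ge_of_le atTop (hitDensity_le_one (A := A) · x))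
        (Eventually.of_forall (hitDensity_nonneg · x))
    · exact isBoundedUnder_of ⟨1, (hitDensity_le_one · x)⟩
    · exact isBoundedUnder_of ⟨0, (hitDensity_nonneg · x)⟩
  simp only [hdens] at hlim
  obtain ⟨S, ⟨l, hS⟩, hSD⟩ :=
    hDHL b T (fun i => isHomogeneous_bSeq (hb i)) D Set.inter_subset_right hlim
  choose u g hu0 hu hg1 hg using fun i =>
    (isTreeEmb_map_val (b := b i)).exists_fan (S := S i) (l := l) (by
      rw [range_map_val]
      exact hS i)
  refine ⟨u, g, ⟨l 0, l 1, hu, hg⟩, hmem _ (hSD ?_), fun a => hmem _ (hSD ?_)⟩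
  · exact Set.mem_iUnion.2 ⟨0, fun i => by rw [hu0]; rfl⟩
  · exact Set.mem_iUnion.2 ⟨1, fun i => by rw [hg1]; exact ⟨a i, rfl⟩⟩

variable [MeasurableSpace Ω]

theorem measurable_hitDensity (hA : ∀ u, MeasurableSet (A u)) (n : ℕ) :
    Measurable (hitDensity A n) :=
  (Finset.measurable_sum _ fun _ _ => measurable_one.indicator (hA _)).div_const _

/-- Under `DHL d`, a family of events of probability at least `ε` indexed by the level product
of the trees of words contains, with probability at least `ε`, a whole vector fan. -/
theorem le_measureReal_exists_fan (hDHL : DHL d) (hb : ∀ i, 2 ≤ b i) (μ : Measure Ω)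
    [IsProbabilityMeasure μ] (hA : ∀ u, MeasurableSet (A u)) {ε : ℝ}
    (hε : ∀ n u, (∀ i, (u i).length = n) → ε ≤ μ.real (A u)) :
    ε ≤ μ.real {x | ∃ u g, (∃ k n, IsFan u g k n) ∧ x ∈ A u ∧
      ∀ a : ∀ i, Fin (b i), x ∈ A fun i => g i (a i)} := by
  classical
  set U := {x | ∃ u g, (∃ k n, IsFan u g k n) ∧ x ∈ A u ∧
      ∀ a : ∀ i, Fin (b i), x ∈ A fun i => g i (a i)} with hU
  have hUm : MeasurableSet U := by
    simp only [hU, Set.ofPred_exists, Set.ofPred_and, Set.ofPred_forall]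
    refine .iUnion fun u => .iUnion fun g => ?_
    refine .inter (.iUnion fun k => .iUnion fun n => .const _) (.inter (hA u) ?_)
    exact .iInter fun a => hA _
  have hlim : Tendsto (fun n => ∫ x in Uᶜ, hitDensity A n x ∂μ) atTop
      (nhds (∫ x in Uᶜ, (0 : ℝ) ∂μ)) := by
    refine tendsto_integral_of_dominated_convergence (fun _ => 1)
      (fun n => (measurable_hitDensity hA n).aestronglyMeasurable) (integrable_const _) ?_ ?_
    · refine fun n => .of_forall fun x => ?_
      rw [Real.norm_of_nonneg (hitDensity_nonneg n x)]
      exact hitDensity_le_one n x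
    · refine (ae_restrict_iff' hUm.compl).2 (.of_forall fun x hx => ?_)
      by_contra h
      exact hx (exists_fan_of_not_tendsto hDHL hb h)
  have hint : ∀ n, ε - μ.real U ≤ ∫ x in Uᶜ, hitDensity A n x ∂μ := by
    intro n
    have : ∀ i, Nonempty (Fin (b i)) := fun i => ⟨⟨0, by have := hb i; omega⟩⟩
    have hN : (0 : ℝ) < Fintype.card (∀ i, Fin n → Fin (b i)) := by
      exact_mod_cast Fintype.card_pos
    simp only [hitDensity]
    rw [integral_div, le_div_iff₀ hN, integral_finsetSum]
    · refine le_trans (by simp [mul_comm])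
        (Finset.card_nsmul_le_sum Finset.univ _ (ε - μ.real U) fun t _ => ?_)
      rw [integral_indicator_one (hA _), measureReal_restrict_apply (hA _)]
      have h₁ := hε n (fun i => List.ofFn (t i)) fun i => List.length_ofFn
      have h₂ := measureReal_inter_add_sdiff (μ := μ) (s := A fun i => List.ofFn (t i)) hUm
      have h₃ := measureReal_mono (μ := μ)
        (Set.inter_subset_right : (A fun i => List.ofFn (t i)) ∩ U ⊆ U)
      rw [Set.sdiff_eq] at h₂
      linarith
    · intro t _
      exact (integrable_const (1 : ℝ)).indicator (hA _)
  have := ge_of_tendsto' hlim hint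
  simp only [integral_zero] at this
  linarith

end Probability

section Coin

open MeasureTheory ProbabilityTheory

variable {q : ℕ}

instance [NeZero q] : IsProbabilityMeasure (uniformOn (Set.univ : Set (Fin q))) :=
  isProbabilityMeasure_uniformOn Set.finite_univ Set.univ_nonempty

/-- The uniform probability measure on the infinite branches of the tree of words over `Fin q`. -/
noncomputable def branchMeasure (q : ℕ) [NeZero q] : Measure (ℕ → Fin q) :=
  Measure.infinitePi fun _ => uniformOn Set.univ

instance [NeZero q] : IsProbabilityMeasure (branchMeasure q) := by
  unfold branchMeasure
  infer_instance

/-- The set of infinite branches passing through the word `v`. -/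
def cyl (v : List (Fin q)) : Set (ℕ → Fin q) := {x | List.ofFn (fun i : Fin v.length => x i) = v}

theorem cyl_eq_pi (v : List (Fin q)) :
    cyl v = Set.pi (Finset.range v.length) fun i => {a | v[i]? = some a} := by
  ext x
  simp only [cyl, Set.mem_pi, Finset.coe_range, Set.mem_Iio, Set.mem_ofPred_eq]
  constructor
  · intro h i hi
    rw [← h]
    simp [hi]
  · intro h
    refine List.ext_getElem? fun i => ?_
    rcases lt_or_ge i v.length with hi | hi
    · rw [h i hi]
      simp [hi]
    · simp [hi]

theorem measurableSet_cyl (v : List (Fin q)) : MeasurableSet (cyl v) := by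
  rw [cyl_eq_pi]
  exact .pi (Finset.countable_toSet _) fun i _ => .of_discrete

theorem branchMeasure_cyl [NeZero q] (v : List (Fin q)) :
    (branchMeasure q).real (cyl v) = ((q : ℝ) ^ v.length)⁻¹ := by
  have h : ∀ i ∈ Finset.range v.length,
      uniformOn (Set.univ : Set (Fin q)) {a | v[i]? = some a} = (q : ENNReal)⁻¹ := by
    intro i hi
    have : {a | v[i]? = some a} = {v[i]'(Finset.mem_range.1 hi)} := by
      ext a
      simp [List.getElem?_eq_getElem (Finset.mem_range.1 hi), eq_comm]
    rw [this, uniformOn_univ]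
    simp
  rw [measureReal_def, branchMeasure, cyl_eq_pi, Measure.infinitePi_pi _ fun _ _ => .of_discrete,
    Finset.prod_congr rfl h]
  simp

theorem prefix_of_mem_cyl {v v' : List (Fin q)} {x : ℕ → Fin q} (h : x ∈ cyl v) (h' : x ∈ cyl v')
    (hle : v.length ≤ v'.length) : v <+: v' := by
  simp only [cyl, Set.mem_ofPred_eq] at h h'
  rw [List.prefix_iff_eq_take, ← h', ← h]
  refine List.ext_getElem (by simpa using hle) ?_
  intro i _ _
  simp

theorem cyl_anti {v v' : List (Fin q)} (h : v <+: v') : cyl v' ⊆ cyl v := by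
  intro x hx
  simp only [cyl, Set.mem_ofPred_eq] at hx ⊢
  rw [List.prefix_iff_eq_take, ← hx] at h
  rw [h]
  refine List.ext_getElem (by simp) ?_
  intro i _ _
  simp

theorem branchMeasure_biUnion_cyl [NeZero q] {B : Set (List (Fin q))} {n : ℕ}
    (hB : ∀ v ∈ B, v.length = n) :
    (branchMeasure q).real (⋃ v ∈ B, cyl v) = B.ncard / (q : ℝ) ^ n := by
  have hfin : B.Finite := (List.finite_length_eq (Fin q) n).subset hB
  lift B to Finset (List (Fin q)) using hfin
  simp only [Finset.mem_coe, Set.ncard_coe_finset] at hB ⊢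
  rw [measureReal_biUnion_finset _ fun v _ => measurableSet_cyl v,
    Finset.sum_congr rfl fun v hv => by rw [branchMeasure_cyl, hB v hv], Finset.sum_const,
    nsmul_eq_mul, div_eq_mul_inv]
  intro v hv v' hv' hne
  refine Set.disjoint_left.2 fun x hx hx' => hne ?_
  have hlen : v.length = v'.length := (hB v hv).trans (hB v' hv').symm
  exact (prefix_of_mem_cyl hx hx' hlen.le).eq_of_length hlen

end Coin

section Correlation

open MeasureTheory

variable {d : ℕ} {b : Fin d → ℕ} {q : ℕ} {E : (∀ i, List (Fin (b i))) → Set (List (Fin q))}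

/-- The infinite branches through `v` that meet `E` at every tuple of the top level `g`. -/
def fanEvent (E : (∀ i, List (Fin (b i))) → Set (List (Fin q)))
    (g : ∀ i, Fin (b i) → List (Fin (b i))) (v : List (Fin q)) : Set (ℕ → Fin q) :=
  cyl v ∩ ⋂ a : ∀ i, Fin (b i), ⋃ v ∈ E fun i => g i (a i), cyl v

theorem measureReal_fanEvent_le [NeZero q] [∀ i, Nonempty (Fin (b i))]
    {g : ∀ i, Fin (b i) → List (Fin (b i))} {v : List (Fin q)} {n : ℕ} (hv : v.length ≤ n)
    (hE : ∀ a : ∀ i, Fin (b i), ∀ w ∈ E fun i => g i (a i), w.length = n) :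
    (branchMeasure q).real (fanEvent E g v) ≤
      {w | v <+: w ∧ ∀ a : ∀ i, Fin (b i), w ∈ E fun i => g i (a i)}.ncard / (q : ℝ) ^ n := by
  rw [← branchMeasure_biUnion_cyl fun w hw => hE (fun _ => Classical.arbitrary _) w (hw.2 _)]
  refine measureReal_mono ?_ (measure_ne_top _ _)
  rintro x ⟨hxv, hx⟩
  simp only [Set.mem_iInter, Set.mem_iUnion, exists_prop] at hx
  obtain ⟨w, hw, hxw⟩ := hx fun _ => Classical.arbitrary _
  have hwn := hE _ w hw
  simp only [Set.mem_iUnion, exists_prop]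
  refine ⟨w, ⟨prefix_of_mem_cyl hxv hxw (by omega), fun a => ?_⟩, hxw⟩
  obtain ⟨w', hw', hxw'⟩ := hx a
  have hlen : w.length = w'.length := hwn.trans (hE a w' hw').symm
  rwa [(prefix_of_mem_cyl hxw hxw' hlen.le).eq_of_length hlen]

/-- The embedding onto the part of the range of `ψ` that lies above the fan `(u, g)`. -/
def extendFan (ψ : ∀ i, List (Fin (b i)) → List (Fin (b i))) (u : ∀ i, List (Fin (b i)))
    (g : ∀ i, Fin (b i) → List (Fin (b i))) (i : Fin d) : List (Fin (b i)) → List (Fin (b i))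
  | [] => ψ i (u i)
  | a :: v => ψ i (g i a ++ v)

theorem isVecEmb_extendFan {ψ : ∀ i, List (Fin (b i)) → List (Fin (b i))} (hψ : IsVecEmb ψ)
    {u : ∀ i, List (Fin (b i))} {g : ∀ i, Fin (b i) → List (Fin (b i))} {k n : ℕ}
    (hg : IsFan u g k n) : IsVecEmb (extendFan ψ u g) := by
  obtain ⟨lev, hlev⟩ := hψ.1
  refine ⟨⟨fun m => if m = 0 then lev k else lev (n + (m - 1)), fun i v => ?_⟩, fun i v a => ?_⟩
  · cases v with
    | nil => simp [extendFan, hlev, hg.1]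
    | cons a v => simp [extendFan, hlev, (hg.2 i a).2]
  · cases v with
    | nil => exact (hψ.2 i _ a).trans (hψ.mono (by simpa using (hg.2 i a).1))
    | cons c v => exact (hψ.2 i _ a).trans (by simp [extendFan])

/-- The correlation theorem for trees of words. -/
theorem exists_correlated_words (hd : 0 < d) (hDHL : DHL d) (hb : ∀ i, 2 ≤ b i) [NeZero q]
    {ε : ℝ} (hε : 0 < ε) {l : ℕ → ℕ} (hl : StrictMono l)
    (hlen : ∀ n t, (∀ i, (t i).length = n) → ∀ v ∈ E t, v.length = l n)
    (hE : ∀ n t, (∀ i, (t i).length = n) → ε * (q : ℝ) ^ l n ≤ (E t).ncard) :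
    ∃ (ρ : ∀ i, List (Fin (b i)) → List (Fin (b i))) (w : List (Fin q)) (θ : ℝ),
      IsVecEmb ρ ∧ w ∈ E (fun i => ρ i []) ∧ 0 < θ ∧
      ∀ n g, IsFan (fun _ => []) g 0 n → ∀ N, (∀ i a, (ρ i (g i a)).length = N) → ∀ p : Fin q,
        θ * (q : ℝ) ^ l N ≤
          {v | w ++ [p] <+: v ∧ ∀ a : ∀ i, Fin (b i), v ∈ E fun i => ρ i (g i (a i))}.ncard := by
  have hne : ∀ i, Nonempty (Fin (b i)) := fun i => ⟨⟨0, by have := hb i; omega⟩⟩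
  have hq : (0 : ℝ) < q := by exact_mod_cast Nat.pos_of_ne_zero (NeZero.ne q)
  let i₀ : Fin d := ⟨0, hd⟩
  let a₀ : Fin (b i₀) := Classical.arbitrary _
  set μ := branchMeasure q
  have hmin : ∀ g w, ∃ p : Fin q, ∀ p' : Fin q,
      μ.real (fanEvent E g (w ++ [p])) ≤ μ.real (fanEvent E g (w ++ [p'])) := fun g w =>
    Finite.exists_min _
  choose pmin hpmin using hmin
  obtain ⟨δ, hδ, hδsum⟩ := ENNReal.exists_pos_sum_of_countable
    (ε := ENNReal.ofReal (ε / q)) (by simpa using div_pos hε hq)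
    ((∀ i, List (Fin (b i))) × (∀ i, Fin (b i) → List (Fin (b i))) × List (Fin q))
  obtain ⟨ψ, hψ, hhom⟩ := exists_homAt
    (c := fun u g₀ w g =>
      (pmin g w, ∀ p, (δ (u, g₀, w) : ℝ) ≤ μ.real (fanEvent E g (w ++ [p]))))
    (Ω := fun r => {w ∈ E r | ∃ n, ∀ i, (r i).length = n}) (by
      intro r
      by_cases h : ∃ n, ∀ i, (r i).length = n
      · obtain ⟨n, hn⟩ := h
        exact (List.finite_length_eq (Fin q) (l n)).subset fun w hw => hlen n r hn w hw.1
      · exact Set.finite_empty.subset fun w hw => h hw.2)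
  obtain ⟨lev, hlev⟩ := hψ.1
  let ptn : (∀ i, List (Fin (b i))) → List (Fin q) → Fin q := fun u w =>
    pmin (fun i a => ψ i (u i ++ [a])) w
  have hptn : ∀ u g k n, IsFan u g k n → ∀ w ∈ E fun i => ψ i (u i),
      pmin (fun i a => ψ i (g i a)) w = ptn u w := by
    intro u g k n hg w hw
    exact congrArg Prod.fst (hhom k k u (fun i a => u i ++ [a])
      ⟨hg.1, fun i a => ⟨List.prefix_rfl, by simp [hg.1]⟩⟩ w
      ⟨hw, lev k, fun i => by rw [hlev, hg.1]⟩ n (k + 1) g (fun i a => u i ++ [a]) hg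
      ⟨hg.1, fun i a => ⟨List.prefix_rfl, by simp [hg.1]⟩⟩ (fun i a => (hg.2 i a).1)
      fun i a => List.prefix_rfl)
  let A : (∀ i, List (Fin (b i))) → Set (ℕ → Fin q) := fun u =>
    ⋃ v ∈ (fun w => w ++ [ptn u w]) '' E fun i => ψ i (u i), cyl v
  have hAmem : ∀ {u x}, x ∈ A u ↔ ∃ w ∈ E fun i => ψ i (u i), x ∈ cyl (w ++ [ptn u w]) := by
    intro u x
    simp [A]
  have hAε : ∀ n u, (∀ i, (u i).length = n) → ε / q ≤ μ.real (A u) := by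
    intro n u hu
    have hu' : ∀ i, (ψ i (u i)).length = lev n := fun i => by rw [hlev, hu]
    have hcount := hE _ _ hu'
    rw [branchMeasure_biUnion_cyl (n := l (lev n) + 1), Set.ncard_image_of_injective,
      div_le_div_iff₀ hq (by positivity), pow_succ, ← mul_assoc]
    · exact mul_le_mul_of_nonneg_right hcount hq.le
    · intro w w' h
      exact (List.append_inj' h rfl).1
    · rintro _ ⟨w, hw, rfl⟩
      simp [hlen _ _ hu' w hw]
  obtain ⟨u, g, k, n, hg, w, hw, hδw⟩ : ∃ u g k n, IsFan u g k n ∧ ∃ w ∈ E fun i => ψ i (u i),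
      (δ (u, g, w) : ℝ) ≤ μ.real (fanEvent E (fun i a => ψ i (g i a)) (w ++ [ptn u w])) := by
    by_contra! hcon
    have hU := le_measureReal_exists_fan hDHL hb μ
      (fun u => .biUnion (Set.to_countable _) fun v _ => measurableSet_cyl v) hAε
    refine absurd (ENNReal.ofReal_le_of_le_toReal hU) (not_le.2 (lt_of_le_of_lt ?_ hδsum))
    let B : (∀ i, List (Fin (b i))) × (∀ i, Fin (b i) → List (Fin (b i))) × List (Fin q) →
        Set (ℕ → Fin q) := fun s =>
      {x | (∃ k n, IsFan s.1 s.2.1 k n) ∧ (s.2.2 ∈ E fun i => ψ i (s.1 i)) ∧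
        x ∈ fanEvent E (fun i a => ψ i (s.2.1 i a)) (s.2.2 ++ [ptn s.1 s.2.2])}
    refine (measure_mono (t := ⋃ s, B s) ?_).trans
      ((measure_iUnion_le _).trans (ENNReal.tsum_le_tsum ?_))
    · rintro x ⟨u, g, hfan, hxu, hxg⟩
      obtain ⟨w, hw, hxw⟩ := hAmem.1 hxu
      refine Set.mem_iUnion.2 ⟨(u, g, w), hfan, hw, hxw, Set.mem_iInter.2 fun a => ?_⟩
      obtain ⟨w', hw', hxw'⟩ := hAmem.1 (hxg a)
      exact Set.mem_biUnion hw' (cyl_anti (List.prefix_append _ _) hxw')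
    · rintro ⟨u, g, w⟩
      by_cases h : (∃ k n, IsFan u g k n) ∧ w ∈ E fun i => ψ i (u i)
      · obtain ⟨⟨k, n, hfan⟩, hw⟩ := h
        refine (measure_mono fun x hx => hx.2.2).trans ?_
        have := hcon u g k n hfan w hw
        rw [← ENNReal.ofReal_coe_nnreal]
        exact (ENNReal.le_ofReal_iff_toReal_le (measure_ne_top _ _) (NNReal.coe_nonneg _)).2 this.le
      · have : B (u, g, w) = ∅ := Set.eq_empty_of_forall_notMem fun x hx => h ⟨hx.1, hx.2.1⟩
        rw [this, measure_empty]
        exact zero_le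
  have hu' : ∀ i, (ψ i (u i)).length = lev k := fun i => by rw [hlev, hg.1]
  have hall : ∀ p, (δ (u, g, w) : ℝ) ≤ μ.real (fanEvent E (fun i a => ψ i (g i a)) (w ++ [p])) :=
    fun p => hδw.trans (hptn u g k n hg w hw ▸ hpmin _ w p)
  refine ⟨extendFan ψ u g, w, δ (u, g, w), isVecEmb_extendFan hψ hg, hw,
    NNReal.coe_pos.2 (hδ _), fun m h hh N hN p => ?_⟩
  have hcons : ∀ i a, ∃ v, h i a = a :: v := fun i a => by
    obtain ⟨v, hv⟩ := (hh.2 i a).1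
    exact ⟨v, by simpa using hv.symm⟩
  choose v hv using hcons
  have hfan : IsFan u (fun i a => g i a ++ v i a) k (n + (m - 1)) := by
    refine ⟨hg.1, fun i a => ⟨(hg.2 i a).1.trans (List.prefix_append _ _), ?_⟩⟩
    have := (hh.2 i a).2
    rw [hv, List.length_cons] at this
    rw [List.length_append, (hg.2 i a).2]
    omega
  have hkn := hg.succ_le i₀ a₀
  obtain ⟨n, rfl⟩ : ∃ n', n = n' + 1 := ⟨n - 1, by omega⟩
  have hcol := congrArg Prod.snd (hhom n k u g hg w ⟨hw, lev k, hu'⟩ _ _ g _ hg hfan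
    (fun _ _ => List.prefix_rfl) fun _ _ => List.prefix_append _ _)
  have hfinal := hcol.mp hall p
  have hρ : (fun i a => extendFan ψ u g i (h i a)) = fun i a => ψ i (g i a ++ v i a) := by
    funext i a
    rw [hv]
    rfl
  have hρ' : ∀ i a, (ψ i (g i a ++ v i a)).length = N := fun i a => by
    rw [← hN i a, hv]
    rfl
  have hlevN : lev k < N := by
    have h₁ := (hψ.2 i₀ (u i₀) a₀).trans (hψ.mono (hfan.2 i₀ a₀).1)
    have h₂ := h₁.length_le
    rw [hρ', List.length_append, hu'] at h₂
    exact h₂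
  have hwlen : (w ++ [p]).length ≤ l N := by
    have := hl hlevN
    rw [List.length_append, hlen _ _ hu' w hw, List.length_singleton]
    omega
  have := hfinal.trans (measureReal_fanEvent_le hwlen fun a =>
    hlen N _ fun i => hρ' i (a i))
  rw [le_div_iff₀ (by positivity)] at this
  refine this.trans_eq ?_
  simp only [hv, extendFan]

end Correlation

theorem IsTreeEmb.ncard_level {q : ℕ} {φ : List (Fin q) → List ℕ} {lev : ℕ → ℕ}
    (h : IsTreeEmb φ lev) (n : ℕ) : (level (Set.range φ) n).ncard = q ^ n := by
  have : level (Set.range φ) n = φ '' {u | u.length = n} := Set.ext fun t => h.mem_level_iff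
  rw [this, Set.ncard_image_of_injective _ h.injective, ← Nat.card_coe_set_eq]
  change Nat.card (List.Vector (Fin q) n) = _
  rw [Nat.card_eq_fintype_card, card_vector, Fintype.card_fin]

theorem IsTreeEmb.finite_level {q : ℕ} {φ : List (Fin q) → List ℕ} {lev : ℕ → ℕ}
    (h : IsTreeEmb φ lev) (n : ℕ) : (level (Set.range φ) n).Finite := by
  have : level (Set.range φ) n = φ '' {u | u.length = n} := Set.ext fun t => h.mem_level_iff
  rw [this]
  exact (List.finite_length_eq (Fin q) n).image φ

theorem le_densRel_of_le_ncard {q : ℕ} {φ : List (Fin q) → List ℕ} {lev : ℕ → ℕ} [NeZero q]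
    (h : IsTreeEmb φ lev) {n : ℕ} {F : Set (List ℕ)} (hF : F ⊆ level (Set.range φ) n)
    {v : List (Fin q)} {B : Set (List (Fin q))} (hB : ∀ u ∈ B, v <+: u ∧ φ u ∈ F) {θ : ℝ}
    (hθ : 0 < θ) (hcard : θ * (q : ℝ) ^ n ≤ B.ncard) : θ ≤ densRel (Set.range φ) n F (φ v) := by
  have hq : (0 : ℝ) < q := by exact_mod_cast Nat.pos_of_ne_zero (NeZero.ne q)
  have hfin := h.finite_level n
  have h₁ : B.ncard ≤ (F ∩ suc (Set.range φ) (φ v)).ncard := by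
    rw [← Set.ncard_image_of_injective B h.injective]
    refine Set.ncard_le_ncard ?_ (hfin.subset (Set.inter_subset_left.trans hF))
    rintro _ ⟨u, hu, rfl⟩
    exact ⟨(hB u hu).2, ⟨u, rfl⟩, h.mono (hB u hu).1⟩
  have h₂ : (F ∩ suc (Set.range φ) (φ v)).ncard ≤
      (level (Set.range φ) n ∩ suc (Set.range φ) (φ v)).ncard :=
    Set.ncard_le_ncard (Set.inter_subset_inter_left _ hF) (hfin.inter_of_left _)
  have h₃ : (level (Set.range φ) n ∩ suc (Set.range φ) (φ v)).ncard ≤ q ^ n := by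
    rw [← h.ncard_level n]
    exact Set.ncard_le_ncard Set.inter_subset_left hfin
  have hpos : 0 < θ * (q : ℝ) ^ n := by positivity
  have h₁' : (B.ncard : ℝ) ≤ (F ∩ suc (Set.range φ) (φ v)).ncard := by exact_mod_cast h₁
  have h₂' : ((F ∩ suc (Set.range φ) (φ v)).ncard : ℝ) ≤
    (level (Set.range φ) n ∩ suc (Set.range φ) (φ v)).ncard := by exact_mod_cast h₂
  have h₃' : ((level (Set.range φ) n ∩ suc (Set.range φ) (φ v)).ncard : ℝ) ≤ (q : ℝ) ^ n := by
    exact_mod_cast h₃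
  rw [densRel, le_div_iff₀ (by linarith)]
  have := mul_le_mul_of_nonneg_left h₃' hθ.le
  linarith

/-- Theorem 3.3: existence of a strongly correlated pair for any dense
level selection, assuming `DHL(d)`. -/
theorem strongly_correlated_exists (d : ℕ) (hd : 1 ≤ d) (hDHL : DHL d)
    (b : Fin d → ℕ) (T : Fin d → Set (List ℕ)) (hT : IsVecHomogeneous b T)
    (bW : ℕ) (W : Set (List ℕ)) (hW : IsHomogeneous bW W)
    (ε : ℝ) (hε0 : 0 < ε) (hε1 : ε ≤ 1)
    (l : ℕ → ℕ) (D : (Fin d → List ℕ) → Set (List ℕ))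
    (hD : IsDenseLevelSel T W l ε D) :
    ∃ (R : Fin d → Set (List ℕ)) (r0 : Fin d → List ℕ) (w : List ℕ) (θ : ℝ),
      IsVecStrongSubtree T R ∧ IsRoot R r0 ∧ w ∈ W ∧ 0 < θ ∧ θ ≤ 1 ∧
        StronglyCorrelated T W bW l D R r0 w θ := by
  have hb : ∀ i, 0 < b i := fun i => by have := (hT i).1; omega
  have : NeZero bW := ⟨by have := hW.1; omega⟩
  choose φ lev hφ hφT using fun i => exists_isTreeEmb_of_isHomogeneous (hT i)
  obtain ⟨φW, levW, hφW, rfl⟩ := exists_isTreeEmb_of_isHomogeneous hW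
  obtain rfl : (fun i => Set.range (φ i)) = T := funext hφT
  obtain ⟨hl, hsel⟩ := hD
  have hlevel : ∀ {n} {t : ∀ i, List (Fin (b i))}, (∀ i, (t i).length = n) →
      (fun i => φ i (t i)) ∈ vecLevel (fun i => Set.range (φ i)) n :=
    fun ht i => (hφ i).mem_level_iff.2 ⟨_, ht i, rfl⟩
  obtain ⟨ρ, w, θ, hρ, hw, hθ, hcount⟩ := exists_correlated_words
    (E := fun t => φW ⁻¹' D fun i => φ i (t i)) hd hDHL (fun i => (hT i).1) hε0 hl
    (by
      intro n t ht v hv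
      obtain ⟨u, hu, huv⟩ := hφW.mem_level_iff.1 ((hsel n _ (hlevel ht)).1 hv)
      rwa [← hφW.injective huv])
    (by
      intro n t ht
      obtain ⟨hsub, hdens⟩ := hsel n _ (hlevel ht)
      rw [Set.ncard_preimage_of_injective_subset_range hφW.injective fun x hx => (hsub hx).1]
      rw [dens, hφW.ncard_level, le_div_iff₀ (by have := NeZero.pos bW; positivity)] at hdens
      exact_mod_cast hdens)
  obtain ⟨⟨m, hm⟩, hρ'⟩ := hρ
  have hχ : ∀ i, IsTreeEmb (fun u => φ i (ρ i u)) fun n => lev i (m n) :=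
    fun i => (hφ i).comp (hm i) (hρ' i)
  refine ⟨fun i => Set.range fun u => φ i (ρ i u), fun i => φ i (ρ i []), φW w, min θ 1,
    ⟨m, fun i => (hφ i).isStrongSubtreeWith (hb i) (hm i) (hρ' i)⟩, fun i => ?_, ⟨w, rfl⟩,
    lt_min hθ one_pos, min_le_right _ _, hw, ?_⟩
  · refine Set.eq_singleton_iff_unique_mem.2 ⟨(hχ i).mem_level_iff.2 ⟨[], rfl, rfl⟩, fun t ht => ?_⟩
    obtain ⟨u, hu, rfl⟩ := (hχ i).mem_level_iff.1 ht
    rw [List.length_eq_zero_iff.1 hu]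
  rintro F ⟨R', ⟨l', hR'⟩, hF⟩ hroot n hn p hp s ⟨hs, hps⟩
  choose u g hu0 hu hg1 hg using fun i => (hχ i).exists_fan (hR' i)
  have hFl := fun i => (hχ i).fan_levels (hg i) (F := F i) (by rw [hF, hu0, hg1])
  have hu_nil : ∀ i, u i = [] := fun i => by
    have := (hFl i).1
    rw [hroot i] at this
    exact (hχ i).injective this
  have htop : ∀ a : ∀ i, Fin (b i), (fun i => φ i (ρ i (g i (a i)))) ∈ vecLevel F 1 :=
    fun a i => by
      rw [(hFl i).2]
      exact ⟨a i, rfl⟩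
  have hN : ∀ i a, (ρ i (g i a)).length = n := by
    have hlen : ∀ i a, (ρ i (g i a)).length = m (l' 1) := fun i a => by rw [hm, (hg i a).2]
    obtain ⟨v, hv, hvn⟩ :=
      (hφ ⟨0, hd⟩).mem_level_iff.1 (hn (htop fun i => ⟨0, hb i⟩) ⟨0, hd⟩)
    intro i a
    rw [hlen, ← hv, (hφ _).injective hvn, hlen]
  obtain ⟨p', rfl⟩ := hφW.immSuc_iff.1 hs
  obtain rfl := eq_of_append_singleton_prefix hps (hφW.2 w p')
  have hfan : IsFan (fun _ => []) g 0 (l' 1) :=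
    ⟨fun _ => rfl, fun i a => ⟨by simpa [hu_nil] using (hg i a).1, (hg i a).2⟩⟩
  refine le_densRel_of_le_ncard hφW ?_
    (B := {v | w ++ [p'] <+: v ∧ ∀ a : ∀ i, Fin (b i), φW v ∈ D fun i => φ i (ρ i (g i (a i)))})
    ?_ (lt_min hθ one_pos) (le_trans ?_ (hcount _ g hfan n hN p'))
  · refine (Set.biInter_subset_of_mem (htop fun i => ⟨0, hb i⟩)).trans ?_
    exact (hsel n _ (hlevel fun i => hN i _)).1
  · rintro v ⟨hv, hvD⟩
    refine ⟨hv, Set.mem_iInter₂.2 fun r hr => ?_⟩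
    have : ∀ i, ∃ a, φ i (ρ i (g i a)) = r i := fun i => by
      have := hr i
      rwa [(hFl i).2] at this
    choose a ha using this
    obtain rfl : (fun i => φ i (ρ i (g i (a i)))) = r := funext ha
    exact hvD a
  · exact mul_le_mul_of_nonneg_right (min_le_left _ _) (by positivity)
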